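/- Let d, k, and γ be nonnegative integers, and let B_{d,γ} denote the set of all nonnegative linear combinations of polynomials of the form x^i·(x+1)^{d−i} + x^j·(x+1)^{d−j} with 0 ≤ i, j ≤ d and i + j ≥ γ. Then for every f ∈ B_{d,γ}, the polynomial T_k(f) lies in B_{d,γ} (equivalently, φ_k(B_{d,γ}) ⊆ B_{d,γ}, where φ_k := T_k/k!). -/

import Mathlib

open Polynomial
open scoped Classical

noncomputable section

/-- The complexification of a real polynomial. -/
def toC (p : ℝ[X]) : ℂ[X] := p.map (algebraMap ℝ ℂ)

/-- A complex polynomial is *stable* if it is identically zero or has no zero with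
positive imaginary part. -/
def StableC (f : ℂ[X]) : Prop := f = 0 ∨ ∀ z : ℂ, 0 < z.im → f.eval z ≠ 0

/-- `Interlaces p q` means `p ≺ q`, i.e. `q + i·p` is stable. -/
def Interlaces (p q : ℝ[X]) : Prop :=
  StableC (toC q + Polynomial.C Complex.I * toC p)

/-- A real polynomial is real-rooted if it is identically zero or all of its complex
zeros are real. -/
def RealRooted (p : ℝ[X]) : Prop :=
  p = 0 ∨ ∀ z : ℂ, (toC p).eval z = 0 → z.im = 0

/-- `Rflip d p = (-1)^d · p(-1-x)`. -/
def Rflip (d : ℕ) (p : ℝ[X]) : ℝ[X] := (-1 : ℝ) ^ d • p.comp (-1 - X)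

/-- The f-polynomial of `h` with respect to `d`:
`f(h;x) = Σ_{k=0}^d h_k x^k (1+x)^{d-k} = (1+x)^d h(x/(1+x))`. -/
def fPoly (d : ℕ) (h : ℝ[X]) : ℝ[X] :=
  ∑ k ∈ Finset.range (d + 1), Polynomial.C (h.coeff k) * X ^ k * (1 + X) ^ (d - k)

/-- The subdivision operator `E`, the unique linear map with `E(binom(x,k)) = x^k`;
here computed via Newton's forward-difference formula
`p = Σ_k (Δ^k p)(0) binom(x,k)` where `Δq = q(x+1) - q(x)`. -/
def subdivE (p : ℝ[X]) : ℝ[X] :=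
  ∑ k ∈ Finset.range (p.natDegree + 1),
    Polynomial.C (((fun q : ℝ[X] => q.comp (X + 1) - q)^[k] p).eval 0) * X ^ k

/-- `Ekd d k = E_k^d = E(x^k (x+1)^(d-k))`. -/
def Ekd (d k : ℕ) : ℝ[X] := subdivE (X ^ k * (X + 1) ^ (d - k))

/-- The cone `𝓔_d` of nonnegative combinations of the `E_k^d`, `0 ≤ k ≤ d`. -/
def coneE (d : ℕ) : Set ℝ[X] :=
  { p | ∃ c : ℕ → ℝ, (∀ i, 0 ≤ c i) ∧ p = ∑ i ∈ Finset.range (d + 1), c i • Ekd d i }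

/-- `𝓐_d = {p ∈ 𝓔_d : R_d(p) ≺ p}`. -/
def Ad (d : ℕ) : Set ℝ[X] := { p | p ∈ coneE d ∧ Interlaces (Rflip d p) p }

/-- `p` is alternatingly increasing with respect to `n`:
`0 ≤ p_0 ≤ p_n ≤ p_1 ≤ p_{n-1} ≤ ⋯ ≤ p_{⌊(n+1)/2⌋}`. -/
def AltInc (n : ℕ) (p : ℝ[X]) : Prop :=
  0 ≤ p.coeff 0 ∧ (∀ k, 2 * k ≤ n → p.coeff k ≤ p.coeff (n - k)) ∧
    (∀ k, 2 * k + 1 ≤ n → p.coeff (n - k) ≤ p.coeff (k + 1))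

/-- The number of excedances of an `r`-colored permutation `(σ, z)`:
indices `k` with `σ k > k`, or `σ k = k` and `z k > 0`. -/
def excC {n r : ℕ} (σ : Equiv.Perm (Fin n)) (z : Fin n → Fin r) : ℕ :=
  (Finset.univ.filter fun k : Fin n => k < σ k ∨ (σ k = k ∧ 0 < (z k : ℕ))).card

/-- The colored Eulerian polynomial `A_{n,r}`. -/
def coloredEulerian (n r : ℕ) : ℝ[X] :=
  ∑ σ : Equiv.Perm (Fin n), ∑ z : Fin n → Fin r, X ^ excC σ z

/-- The colored derangement polynomial `d_{n,r}`: the sum of `x^{exc(σ,z)}` over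
colored permutations with no fixed point of color `0`. -/
def coloredDerangement (n r : ℕ) : ℝ[X] :=
  ∑ σ : Equiv.Perm (Fin n),
    ∑ z ∈ Finset.univ.filter (fun z : Fin n → Fin r => ∀ k, ¬(σ k = k ∧ (z k : ℕ) = 0)),
      X ^ excC σ z

/-- The number of excedances of a permutation. -/
def excP {n : ℕ} (σ : Equiv.Perm (Fin n)) : ℕ :=
  (Finset.univ.filter fun k : Fin n => k < σ k).card

/-- The Eulerian polynomial `A_n`. -/
def eulerianPoly (n : ℕ) : ℝ[X] := ∑ σ : Equiv.Perm (Fin n), X ^ excP σ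

/-- The derangement polynomial `d_n`. -/
def derangePoly (n : ℕ) : ℝ[X] :=
  ∑ σ ∈ Finset.univ.filter (fun σ : Equiv.Perm (Fin n) => ∀ k, σ k ≠ k), X ^ excP σ

/-- The linear map `D` with `D(x^k) = d_k`. -/
def Dmap (p : ℝ[X]) : ℝ[X] :=
  ∑ k ∈ Finset.range (p.natDegree + 1), p.coeff k • derangePoly k

/-- Stability for multivariate complex polynomials: identically zero or nonvanishing
whenever all coordinates have positive imaginary part. -/
def MvStable {n : ℕ} (P : MvPolynomial (Fin n) ℂ) : Prop :=
  P = 0 ∨ ∀ z : Fin n → ℂ, (∀ j, 0 < (z j).im) → MvPolynomial.eval z P ≠ 0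

/-- The operator `T_k(f)(x) = Σ_{i=0}^k (-1)^{k-i} binom(k,i) f((i+1)x)`. -/
def Tk (k : ℕ) (f : ℝ[X]) : ℝ[X] :=
  ∑ i ∈ Finset.range (k + 1),
    ((-1 : ℝ) ^ (k - i) * (k.choose i : ℝ)) • f.comp (Polynomial.C ((i : ℝ) + 1) * X)

/-- The cone `B_{d,γ}` of nonnegative combinations of the polynomials
`x^i (x+1)^{d-i} + x^j (x+1)^{d-j}` with `i + j ≥ γ`. -/
def coneBsum (d γ : ℕ) : Set ℝ[X] :=
  { p | ∃ c : ℕ × ℕ → ℝ, (∀ ij, 0 ≤ c ij) ∧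
      p = ∑ ij ∈ (Finset.range (d + 1) ×ˢ Finset.range (d + 1)).filter
            (fun ij => γ ≤ ij.1 + ij.2),
          c ij • (X ^ ij.1 * (X + 1) ^ (d - ij.1) + X ^ ij.2 * (X + 1) ^ (d - ij.2)) }

/-- The cone `B_{d,m}` of nonnegative combinations of the polynomials
`x^j (mx+1)^{d-j}`, `0 ≤ j ≤ d`. -/
def coneBm (d m : ℕ) : Set ℝ[X] :=
  { p | ∃ c : ℕ → ℝ, (∀ j, 0 ≤ c j) ∧
      p = ∑ j ∈ Finset.range (d + 1), c j • (X ^ j * (Polynomial.C (m : ℝ) * X + 1) ^ (d - j)) }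

end
/-- All iterated forward differences are nonnegative. -/
def AbsMono (f : ℕ → ℝ) : Prop := ∀ k s, 0 ≤ (fwdDiff 1)^[k] f s

theorem AbsMono.diff {f : ℕ → ℝ} (hf : AbsMono f) : AbsMono (fwdDiff 1 f) := by
  intro k s
  have := hf (k + 1) s
  rwa [Function.iterate_succ_apply] at this

theorem AbsMono.shift {f : ℕ → ℝ} (hf : AbsMono f) : AbsMono (fun s => f (s + 1)) := by
  intro k s
  rw [fwdDiff_iter_comp_add]
  exact hf k (s + 1)

theorem AbsMono.mul {f g : ℕ → ℝ} (hf : AbsMono f) (hg : AbsMono g) : AbsMono (f * g) := by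
  intro k
  induction k generalizing f g with
  | zero =>
    intro s
    exact mul_nonneg (hf 0 s) (hg 0 s)
  | succ k ih =>
    intro s
    have h : fwdDiff 1 (f * g) = fwdDiff 1 f * (fun s => g (s + 1)) + f * fwdDiff 1 g := by
      funext t
      simp only [fwdDiff, Pi.mul_apply, Pi.add_apply]
      ring
    rw [Function.iterate_succ_apply, h, fwdDiff_iter_add]
    exact add_nonneg (ih hf.diff hg.shift s) (ih hf hg.diff s)

theorem absMono_const (c : ℝ) (hc : 0 ≤ c) : AbsMono (fun _ => c) := by
  intro k
  induction k generalizing c with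
  | zero => intro s; exact hc
  | succ k ih =>
    intro s
    rw [Function.iterate_succ_apply, fwdDiff_const]
    exact ih 0 le_rfl s

theorem absMono_id : AbsMono (fun s => (s : ℝ)) := by
  intro k s
  cases k with
  | zero => simp
  | succ k =>
    have h : fwdDiff 1 (fun s : ℕ => (s : ℝ)) = fun _ => 1 := by
      funext t
      simp [fwdDiff]
    rw [Function.iterate_succ_apply, h]
    exact absMono_const 1 zero_le_one k s

theorem AbsMono.pow {f : ℕ → ℝ} (hf : AbsMono f) (n : ℕ) : AbsMono (f ^ n) := by
  induction n with
  | zero =>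
    rw [pow_zero]
    exact absMono_const 1 zero_le_one
  | succ n ih =>
    rw [pow_succ]
    exact ih.mul hf

/-- The weight of `(s+1)^i s^m` under the alternating sum. -/
noncomputable def wt (k i m : ℕ) : ℝ :=
  ∑ s ∈ Finset.range (k + 1),
    ((-1 : ℝ) ^ (k - s) * (k.choose s : ℝ)) * (((s : ℝ) + 1) ^ i * (s : ℝ) ^ m)

theorem wt_nonneg (k i m : ℕ) : 0 ≤ wt k i m := by
  have h := ((absMono_id.shift.pow i).mul (absMono_id.pow m)) k 0
  rw [fwdDiff_iter_eq_sum_shift] at h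
  unfold wt
  convert h using 2 with s hs
  simp

/-- The basis polynomials. -/
noncomputable def bb (d i : ℕ) : ℝ[X] := X ^ i * (X + 1) ^ (d - i)

theorem bb_comp (d i s : ℕ) :
    (bb d i).comp (C ((s : ℝ) + 1) * X) = ∑ m ∈ Finset.range (d - i + 1),
      (((d - i).choose m : ℝ) * (((s : ℝ) + 1) ^ i * (s : ℝ) ^ m)) • bb d (i + m) := by
  have h : (C ((s : ℝ) + 1) * X + 1 : ℝ[X]) = C (s : ℝ) * X + (X + 1) := by
    rw [C_add, C_1]; ring
  simp only [bb, mul_comp, pow_comp, add_comp, X_comp, one_comp]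
  rw [h, add_pow, Finset.mul_sum]
  refine Finset.sum_congr rfl fun m hm => ?_
  rw [smul_eq_C_mul, Nat.sub_add_eq, C_mul, C_mul, C_pow, C_pow, ← C_eq_natCast, mul_pow, mul_pow,
    pow_add]
  simp only [map_natCast]
  ring

theorem Tk_bb (d k i : ℕ) :
    Tk k (bb d i) = ∑ m ∈ Finset.range (d - i + 1),
      (((d - i).choose m : ℝ) * wt k i m) • bb d (i + m) := by
  unfold Tk wt
  simp only [bb_comp, Finset.smul_sum, Finset.mul_sum, Finset.sum_smul, smul_smul]
  rw [Finset.sum_comm]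
  refine Finset.sum_congr rfl fun m hm => Finset.sum_congr rfl fun s hs => ?_
  congr 1
  ring

theorem wt_total (d k i : ℕ) (hi : i ≤ d) :
    ∑ m ∈ Finset.range (d - i + 1), ((d - i).choose m : ℝ) * wt k i m = wt k d 0 := by
  unfold wt
  simp only [Finset.mul_sum]
  rw [Finset.sum_comm]
  refine Finset.sum_congr rfl fun s hs => ?_
  have h : ((s : ℝ) + 1) ^ d = ((s : ℝ) + 1) ^ i * ((s : ℝ) + 1) ^ (d - i) := by
    rw [← pow_add, Nat.add_sub_cancel' hi]
  rw [pow_zero, mul_one, h, add_pow (s : ℝ) 1 (d - i), Finset.mul_sum, Finset.mul_sum]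
  refine Finset.sum_congr rfl fun m hm => ?_
  rw [one_pow]
  ring

theorem cone_zero (d γ : ℕ) : (0 : ℝ[X]) ∈ coneBsum d γ :=
  ⟨fun _ => 0, fun _ => le_rfl, by simp⟩

theorem cone_add {d γ : ℕ} {p q : ℝ[X]} (hp : p ∈ coneBsum d γ) (hq : q ∈ coneBsum d γ) :
    p + q ∈ coneBsum d γ := by
  obtain ⟨c, hc, rfl⟩ := hp
  obtain ⟨c', hc', rfl⟩ := hq
  refine ⟨fun x => c x + c' x, fun x => add_nonneg (hc x) (hc' x), ?_⟩
  rw [← Finset.sum_add_distrib]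
  simp only [add_smul]

theorem cone_smul {d γ : ℕ} {p : ℝ[X]} {a : ℝ} (ha : 0 ≤ a) (hp : p ∈ coneBsum d γ) :
    a • p ∈ coneBsum d γ := by
  obtain ⟨c, hc, rfl⟩ := hp
  refine ⟨fun x => a * c x, fun x => mul_nonneg ha (hc x), ?_⟩
  rw [Finset.smul_sum]
  simp only [mul_smul]

theorem cone_sum {ι : Type*} {d γ : ℕ} (s : Finset ι) (p : ι → ℝ[X])
    (hp : ∀ i ∈ s, p i ∈ coneBsum d γ) : ∑ i ∈ s, p i ∈ coneBsum d γ :=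
  Finset.sum_induction p (· ∈ coneBsum d γ) (fun _ _ => cone_add) (cone_zero d γ) hp

theorem cone_gen {d γ i j : ℕ} (hi : i ≤ d) (hj : j ≤ d) (h : γ ≤ i + j) :
    bb d i + bb d j ∈ coneBsum d γ := by
  refine ⟨fun x => if x = (i, j) then 1 else 0, fun x => by dsimp only; split_ifs <;> norm_num, ?_⟩
  rw [Finset.sum_eq_single (i, j)]
  · simp [bb]
  · intro x _ hx
    simp [hx]
  · intro hx
    exact absurd (by simp [h]; omega) hx

theorem Tk_add (k : ℕ) (p q : ℝ[X]) : Tk k (p + q) = Tk k p + Tk k q := by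
  simp only [Tk, add_comp, smul_add, Finset.sum_add_distrib]

theorem Tk_smul (k : ℕ) (a : ℝ) (p : ℝ[X]) : Tk k (a • p) = a • Tk k p := by
  simp only [Tk, smul_comp, Finset.smul_sum]
  exact Finset.sum_congr rfl fun i _ => smul_comm _ _ _

theorem Tk_sum {ι : Type*} (k : ℕ) (s : Finset ι) (p : ι → ℝ[X]) :
    Tk k (∑ i ∈ s, p i) = ∑ i ∈ s, Tk k (p i) := by
  induction s using Finset.induction_on with
  | empty => simp [Tk]
  | insert a s ha ih => rw [Finset.sum_insert ha, Finset.sum_insert ha, Tk_add, ih]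

/-- Product coupling of two nonnegative combinations of the same total mass. -/
theorem cone_couple {ι κ : Type*} {d γ : ℕ} (s : Finset ι) (t : Finset κ) (p : ι → ℝ) (q : κ → ℝ)
    (u : ι → ℝ[X]) (v : κ → ℝ[X]) (hp : ∀ i ∈ s, 0 ≤ p i) (hq : ∀ j ∈ t, 0 ≤ q j) (M : ℝ)
    (hM : ∑ i ∈ s, p i = M) (hM' : ∑ j ∈ t, q j = M)
    (h : ∀ i ∈ s, ∀ j ∈ t, u i + v j ∈ coneBsum d γ) :
    ∑ i ∈ s, p i • u i + ∑ j ∈ t, q j • v j ∈ coneBsum d γ := by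
  have hM0 : 0 ≤ M := hM ▸ Finset.sum_nonneg hp
  rcases hM0.eq_or_lt with h0 | hpos
  · subst h0
    rw [Finset.sum_eq_zero_iff_of_nonneg hp] at hM
    rw [Finset.sum_eq_zero_iff_of_nonneg hq] at hM'
    rw [Finset.sum_eq_zero fun i hi => by rw [hM i hi, zero_smul],
      Finset.sum_eq_zero fun i hi => by rw [hM' i hi, zero_smul], add_zero]
    exact cone_zero d γ
  · have key : ∑ i ∈ s, p i • u i + ∑ j ∈ t, q j • v j
        = M⁻¹ • ∑ i ∈ s, ∑ j ∈ t, (p i * q j) • (u i + v j) := by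
      rw [eq_inv_smul_iff₀ hpos.ne']
      simp only [smul_add, Finset.sum_add_distrib]
      congr 1
      · rw [Finset.smul_sum]
        refine Finset.sum_congr rfl fun i _ => ?_
        rw [← Finset.sum_smul, ← Finset.mul_sum, hM', smul_smul, mul_comm]
      · rw [Finset.sum_comm, Finset.smul_sum]
        refine Finset.sum_congr rfl fun j _ => ?_
        rw [← Finset.sum_smul, ← Finset.sum_mul, hM, smul_smul]
    rw [key]
    exact cone_smul (inv_nonneg.2 hM0) (cone_sum _ _ fun i hi => cone_sum _ _ fun j hj =>
      cone_smul (mul_nonneg (hp i hi) (hq j hj)) (h i hi j hj))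

theorem Tk_gen {d γ i j : ℕ} (k : ℕ) (hi : i ≤ d) (hj : j ≤ d) (h : γ ≤ i + j) :
    Tk k (bb d i + bb d j) ∈ coneBsum d γ := by
  rw [Tk_add, Tk_bb, Tk_bb]
  refine cone_couple _ _ _ _ _ _ (fun m _ => mul_nonneg (Nat.cast_nonneg _) (wt_nonneg _ _ _))
    (fun m _ => mul_nonneg (Nat.cast_nonneg _) (wt_nonneg _ _ _)) _ (wt_total d k i hi)
    (wt_total d k j hj) ?_
  intro m hm n hn
  rw [Finset.mem_range] at hm hn
  exact cone_gen (by omega) (by omega) (by omega)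

/-- the cone `B_{d,γ}` spanned by the polynomials
`x^i (x+1)^{d-i} + x^j (x+1)^{d-j}` with `i + j ≥ γ` is preserved by `T_k`
(equivalently by `φ_k = T_k/k!`). -/
theorem stmt18 (d γ k : ℕ) (f : ℝ[X]) (hf : f ∈ coneBsum d γ) :
    Tk k f ∈ coneBsum d γ := by
  obtain ⟨c, hc, rfl⟩ := hf
  rw [Tk_sum]
  refine cone_sum _ _ fun x hx => ?_
  rw [Tk_smul]
  rw [Finset.mem_filter, Finset.mem_product, Finset.mem_range, Finset.mem_range] at hx
  exact cone_smul (hc x) (Tk_gen k (by omega) (by omega) hx.2)
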